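/- arXiv:1604.02870 — 6 statements merged into one kernel-verified Lean document; each statement's English description precedes it below -/
import Mathlib

section
/- Let a, b, c be natural numbers, not all equal to zero. Then ∑_{α,β,γ ≥ 0} C(a, α+β) · C(b, β+γ) · C(c, γ+α) = 2^{a+b+c-1} - ∑_{ℓ=0}^{a-2} C(a+b+c-1, ℓ) - ∑_{ℓ=0}^{b-2} C(a+b+c-1, ℓ) - ∑_{ℓ=0}^{c-2} C(a+b+c-1, ℓ), as integers, where C(n,m) denotes the binomial coefficient (so C(n,m)=0 for m>n, making the triple sum finite), and a sum ∑_{ℓ=0}^{u} is empty when u < 0. -/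
/-- The binomially weighted sum `∑ k ≤ n, C(n, k) * g k`. -/
def binomSum (n : ℕ) (g : ℕ → ℤ) : ℤ :=
  ∑ k ∈ Finset.range (n + 1), (n.choose k : ℤ) * g k

theorem binomSum_congr {n : ℕ} {f g : ℕ → ℤ} (h : ∀ k ≤ n, f k = g k) :
    binomSum n f = binomSum n g :=
  Finset.sum_congr rfl fun k hk => by rw [h k (by simpa [Nat.lt_succ_iff] using hk)]

theorem binomSum_add (n : ℕ) (f g : ℕ → ℤ) :
    binomSum n (fun k => f k + g k) = binomSum n f + binomSum n g := by
  simp only [binomSum, mul_add, Finset.sum_add_distrib]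

theorem binomSum_sub (n : ℕ) (f g : ℕ → ℤ) :
    binomSum n (fun k => f k - g k) = binomSum n f - binomSum n g := by
  simp only [binomSum, mul_sub, Finset.sum_sub_distrib]

theorem binomSum_succ (n : ℕ) (g : ℕ → ℤ) :
    binomSum (n + 1) g = binomSum n g + binomSum n (fun k => g (k + 1)) := by
  have h : binomSum n g =
      ∑ k ∈ Finset.range (n + 1), (n.choose (k + 1) : ℤ) * g (k + 1) + g 0 := by
    rw [binomSum, Finset.sum_range_succ', Finset.sum_range_succ]
    simp
  rw [h, binomSum, Finset.sum_range_succ', binomSum]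
  simp only [Nat.choose_succ_succ, Nat.cast_add, add_mul, Finset.sum_add_distrib]
  simp
  ring

theorem binomSum_reflect (n : ℕ) (g : ℕ → ℤ) :
    binomSum n g = binomSum n (fun k => g (n - k)) := by
  rw [binomSum, ← Finset.sum_range_reflect, binomSum]
  refine Finset.sum_congr rfl fun k hk => ?_
  have hk : k ≤ n := by simpa [Nat.lt_succ_iff] using hk
  rw [Nat.add_sub_cancel, Nat.choose_symm hk]

theorem binomSum_comm (m n : ℕ) (g : ℕ → ℕ → ℤ) :
    binomSum m (fun p => binomSum n (g p)) =
      binomSum n (fun q => binomSum m (fun p => g p q)) := by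
  simp only [binomSum, Finset.mul_sum]
  rw [Finset.sum_comm]
  simp only [mul_left_comm]

/-- Vandermonde's identity, in weighted form. -/
theorem binomSum_binomSum (m n : ℕ) (g : ℕ → ℤ) :
    binomSum m (fun p => binomSum n (fun q => g (p + q))) = binomSum (m + n) g := by
  induction m generalizing g with
  | zero => simp [binomSum]
  | succ m ih =>
    rw [binomSum_succ, ih, Nat.add_right_comm m 1 n, binomSum_succ,
      ← ih (fun k => g (k + 1))]
    simp only [Nat.add_right_comm]

theorem binomSum_binomSum_binomSum (a b c : ℕ) (g : ℕ → ℤ) :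
    binomSum a (fun p => binomSum b (fun q => binomSum c (fun r => g (p + q + r)))) =
      binomSum (a + b + c) g := by
  rw [← binomSum_binomSum (a + b) c, ← binomSum_binomSum a b]

theorem binomSum_even (n : ℕ) :
    binomSum (n + 1) (fun k => if Even k then 1 else 0) = 2 ^ n := by
  rw [binomSum_succ, ← binomSum_add, ← Nat.cast_two, ← Nat.cast_pow, ← Nat.sum_range_choose,
    binomSum, Nat.cast_sum]
  refine Finset.sum_congr rfl fun k _ => ?_
  by_cases hk : Even k <;> simp [hk, Nat.even_add_one]

theorem binomSum_tail (a b c n : ℕ) (hn : a + b + c = n + 1) :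
    binomSum a (fun p => binomSum b (fun q => binomSum c (fun r =>
      if Even (p + q + r) ∧ q + r + 2 ≤ p then 1 else 0))) =
      ∑ k ∈ Finset.range (a - 1), (n.choose k : ℤ) := by
  have h : binomSum a (fun p => binomSum b (fun q => binomSum c (fun r =>
      if Even (p + q + r) ∧ q + r + 2 ≤ p then 1 else 0))) =
      binomSum (n + 1) (fun s => if Even (a + s) ∧ s + 2 ≤ a then 1 else 0) := by
    rw [← hn, ← binomSum_binomSum_binomSum, binomSum_reflect]
    refine binomSum_congr fun p hp => binomSum_congr fun q _ => binomSum_congr fun r _ => ?_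
    refine if_congr ?_ rfl rfl
    simp only [Nat.even_iff]
    omega
  rw [h, binomSum_succ, ← binomSum_add, binomSum]
  have h' : Finset.range (a - 1) = (Finset.range (n + 1)).filter (fun k => k + 2 ≤ a) := by
    ext k
    simp only [Finset.mem_range, Finset.mem_filter]
    omega
  rw [h', Finset.sum_filter]
  refine Finset.sum_congr rfl fun k _ => ?_
  simp only [Nat.even_iff]
  split_ifs <;> omega

/-- Summing over `(α, β, γ)` amounts to summing over the triples `(p, q, r)` of even sum
satisfying the triangle inequalities. -/
theorem finsum_choose_eq_binomSum (a b c : ℕ) :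
    (∑ᶠ α : ℕ, ∑ᶠ β : ℕ, ∑ᶠ γ : ℕ,
        (a.choose (α + β) * b.choose (β + γ) * c.choose (γ + α) : ℤ)) =
      binomSum a (fun p => binomSum b (fun q => binomSum c (fun r =>
        if Even (p + q + r) ∧ p ≤ q + r ∧ q ≤ p + r ∧ r ≤ p + q then 1 else 0))) := by
  have hγ (α β : ℕ) :
      ∑ᶠ γ : ℕ, (a.choose (α + β) * b.choose (β + γ) * c.choose (γ + α) : ℤ) =
      ∑ γ ∈ Finset.range (b + 1),
        (a.choose (α + β) * b.choose (β + γ) * c.choose (γ + α) : ℤ) := by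
    refine finsum_eq_sum_of_support_subset _ fun γ h => ?_
    by_contra hγ
    have : b < β + γ := by simp at hγ; omega
    simp [Nat.choose_eq_zero_of_lt this] at h
  have hβ (α : ℕ) : ∑ᶠ β : ℕ, ∑ γ ∈ Finset.range (b + 1),
        (a.choose (α + β) * b.choose (β + γ) * c.choose (γ + α) : ℤ) =
      ∑ β ∈ Finset.range (a + 1), ∑ γ ∈ Finset.range (b + 1),
        (a.choose (α + β) * b.choose (β + γ) * c.choose (γ + α) : ℤ) := by
    refine finsum_eq_sum_of_support_subset _ fun β h => ?_
    by_contra hβ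
    have : a < α + β := by simp at hβ; omega
    simp [Nat.choose_eq_zero_of_lt this] at h
  have hα : ∑ᶠ α : ℕ, ∑ β ∈ Finset.range (a + 1), ∑ γ ∈ Finset.range (b + 1),
        (a.choose (α + β) * b.choose (β + γ) * c.choose (γ + α) : ℤ) =
      ∑ α ∈ Finset.range (a + 1), ∑ β ∈ Finset.range (a + 1), ∑ γ ∈ Finset.range (b + 1),
        (a.choose (α + β) * b.choose (β + γ) * c.choose (γ + α) : ℤ) := by
    refine finsum_eq_sum_of_support_subset _ fun α h => ?_
    by_contra hα
    have (β : ℕ) : a < α + β := by simp at hα; omega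
    simp [Nat.choose_eq_zero_of_lt (this _)] at h
  simp only [hγ, hβ]
  rw [hα]
  simp only [binomSum, Finset.mul_sum, ← Finset.sum_product']
  refine Finset.sum_bij_ne_zero (fun (x : ℕ × ℕ × ℕ) _ _ => (x.1 + x.2.1, x.2.1 + x.2.2, x.2.2 + x.1))
    ?_ ?_ ?_ ?_
  · rintro ⟨α, β, γ⟩ - h
    simp only [ne_eq, mul_eq_zero, Nat.cast_eq_zero, Nat.choose_eq_zero_iff] at h
    simp only [Finset.mem_product, Finset.mem_range]
    omega
  · rintro ⟨α, β, γ⟩ - - ⟨α', β', γ'⟩ - - h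
    simp only [Prod.mk.injEq] at h ⊢
    omega
  · rintro ⟨p, q, r⟩ hm h
    simp only [Finset.mem_product, Finset.mem_range] at hm
    have ht : Even (p + q + r) ∧ p ≤ q + r ∧ q ≤ p + r ∧ r ≤ p + q := by
      by_contra ht
      simp [ht] at h
    obtain ⟨⟨s, hs⟩, ht⟩ := ht
    have hp : s - q + (s - r) = p := by omega
    have hq : s - r + (s - p) = q := by omega
    have hr : s - p + (s - q) = r := by omega
    refine ⟨(s - q, s - r, s - p), ?_, ?_, ?_⟩
    · simp only [Finset.mem_product, Finset.mem_range]
      omega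
    · simp only [hp, hq, hr, ne_eq, mul_eq_zero, Nat.cast_eq_zero, Nat.choose_eq_zero_iff]
      omega
    · simp only [hp, hq, hr]
  · rintro ⟨α, β, γ⟩ - -
    have ht : Even (α + β + (β + γ) + (γ + α)) ∧ α + β ≤ β + γ + (γ + α) ∧
        β + γ ≤ α + β + (γ + α) ∧ γ + α ≤ α + β + (β + γ) :=
      ⟨⟨α + β + γ, by ring⟩, by omega, by omega, by omega⟩
    simp only [ht, and_self, if_true]
    ring


/-- Theorems 5.1(3) and 5.2 of the paper combined: the purely binomial
identity expressing that the two closed forms for the number of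
triangulations of a triangle with sides subdivided by `a`, `b`, `c` points
agree. The triple sum over all `α, β, γ ≥ 0` has finitely many nonzero
terms (the binomial `C(n,m)` vanishes for `m > n`), so it is expressed with
`finsum`; the sums `∑_{ℓ=0}^{a-2}` are empty when `a ≤ 1` (note
`Finset.range (a-1)`, with truncated subtraction in `ℕ`, is empty in
exactly that case). -/
theorem triple_binomial_sum_eq (a b c : ℕ) (h : ¬(a = 0 ∧ b = 0 ∧ c = 0)) :
    (∑ᶠ α : ℕ, ∑ᶠ β : ℕ, ∑ᶠ γ : ℕ,
        (a.choose (α + β) * b.choose (β + γ) * c.choose (γ + α) : ℤ)) =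
      2 ^ (a + b + c - 1) -
        ∑ ℓ ∈ Finset.range (a - 1), ((a + b + c - 1).choose ℓ : ℤ) -
        ∑ ℓ ∈ Finset.range (b - 1), ((a + b + c - 1).choose ℓ : ℤ) -
        ∑ ℓ ∈ Finset.range (c - 1), ((a + b + c - 1).choose ℓ : ℤ) := by
  obtain ⟨n, hn⟩ : ∃ n, a + b + c = n + 1 := Nat.exists_eq_succ_of_ne_zero (by omega)
  rw [finsum_choose_eq_binomSum, hn, Nat.add_sub_cancel, ← binomSum_even, ← hn,
    ← binomSum_binomSum_binomSum, ← binomSum_tail a b c n hn,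
    ← binomSum_tail b a c n (by omega), ← binomSum_tail c a b n (by omega),
    binomSum_comm b a, binomSum_comm c a]
  simp only [binomSum_comm c b, ← binomSum_sub]
  refine binomSum_congr fun p _ => binomSum_congr fun q _ => binomSum_congr fun r _ => ?_
  simp only [Nat.even_iff]
  split_ifs <;> omega
end

section
/- Let a, b, c be natural numbers and set s = a+b+c+2. Then ∑_{i=0}^{a} ∑_{j=0}^{b} C(i+j, i) · C(a+b+c+1-i-j, c) = 2^s - ∑_{ℓ=0}^{a} C(s, ℓ) - ∑_{ℓ=0}^{b} C(s, ℓ) - ∑_{ℓ=0}^{c} C(s, ℓ), where C(n,m) denotes the binomial coefficient. -/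
/-- A solution of the inhomogeneous Pascal recurrence which vanishes on both axes is the
convolution of its source term with the binomial coefficients. -/
theorem sum_sum_choose_mul_eq_of_recurrence {R : Type*} [CommSemiring R] {f h : ℕ → ℕ → R}
    (f_zero_left : ∀ n, f 0 n = 0) (f_zero_right : ∀ m, f m 0 = 0)
    (f_succ : ∀ m n, f (m + 1) (n + 1) = f m (n + 1) + f (m + 1) n + h m n) (m n : ℕ) :
    ∑ i ∈ Finset.range m, ∑ j ∈ Finset.range n,
      ((i + j).choose i : R) * h (m - 1 - i) (n - 1 - j) = f m n := by
  induction m generalizing n with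
  | zero => simp [f_zero_left]
  | succ m ihm =>
    induction n with
    | zero => simp [f_zero_right]
    | succ n ihn =>
      have pascal (i j : ℕ) : ((i + 1 + (j + 1)).choose (i + 1) : R) =
          (i + (j + 1)).choose i + (i + 1 + j).choose (i + 1) := by
        rw [show i + 1 + (j + 1) = i + (j + 1) + 1 by ring, Nat.choose_succ_succ,
          show i + (j + 1) = i + 1 + j by ring, Nat.cast_add]
      have sub_one_sub (k l : ℕ) : k - 1 - l = k - (l + 1) := by lia
      rw [f_succ, ← ihm, ← ihn]
      simp only [Finset.sum_range_succ' _ m, Finset.sum_range_succ' _ n, Nat.add_sub_cancel,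
        pascal, add_mul, Finset.sum_add_distrib, sub_one_sub, Nat.sub_zero, Nat.add_zero,
        Nat.zero_add, Nat.choose_self, Nat.choose_zero_right, Nat.cast_one, one_mul]
      ring

/-- Pascal's rule for partial sums of a row of binomial coefficients. -/
theorem sum_range_succ_choose_succ (n k : ℕ) :
    ∑ l ∈ Finset.range (k + 1), (n + 1).choose l =
      ∑ l ∈ Finset.range (k + 1), n.choose l + ∑ l ∈ Finset.range k, n.choose l := by
  rw [Finset.sum_range_succ', Finset.sum_range_succ' (fun l => n.choose l)]
  simp only [Nat.choose_succ_succ, Finset.sum_add_distrib, Nat.choose_zero_right]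
  ring

/-- Complementary partial sums of a row of binomial coefficients add up to a power of two. -/
theorem sum_range_choose_add_sum_range_choose (n k : ℕ) :
    ∑ l ∈ Finset.range n, (n + k).choose l + ∑ l ∈ Finset.range (k + 1), (n + k).choose l =
      2 ^ (n + k) := by
  rw [← Nat.sum_range_choose, add_assoc n k 1, Finset.sum_range_add _ n (k + 1),
    ← Finset.sum_range_reflect _ (k + 1)]
  congr 1
  refine Finset.sum_congr rfl fun l hl => ?_
  rw [Finset.mem_range] at hl
  exact Nat.choose_symm_of_eq_add (by lia)

/-- The key binomial computation in the proof of Theorem 5.1(2) of the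
paper: evaluation of the coefficient of `x^a y^b z^c` in
`1/((1-x-y)(1-y-z)(1-z-x))`. -/
theorem double_sum_binomial_eq (a b c : ℕ) :
    (∑ i ∈ Finset.range (a + 1), ∑ j ∈ Finset.range (b + 1),
        ((i + j).choose i * (a + b + c + 1 - i - j).choose c : ℤ)) =
      2 ^ (a + b + c + 2) -
        ∑ ℓ ∈ Finset.range (a + 1), ((a + b + c + 2).choose ℓ : ℤ) -
        ∑ ℓ ∈ Finset.range (b + 1), ((a + b + c + 2).choose ℓ : ℤ) -
        ∑ ℓ ∈ Finset.range (c + 1), ((a + b + c + 2).choose ℓ : ℤ) := by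
  have key := sum_sum_choose_mul_eq_of_recurrence (R := ℤ)
    (f := fun m n => 2 ^ (m + n + c) - ∑ ℓ ∈ Finset.range m, ((m + n + c).choose ℓ : ℤ) -
      ∑ ℓ ∈ Finset.range n, ((m + n + c).choose ℓ : ℤ) -
      ∑ ℓ ∈ Finset.range (c + 1), ((m + n + c).choose ℓ : ℤ))
    (h := fun m n => ((m + n + c + 1).choose c : ℤ)) ?_ ?_ ?_ (a + 1) (b + 1)
  · rw [show a + b + c + 2 = a + 1 + (b + 1) + c by ring, ← key]
    refine Finset.sum_congr rfl fun i hi => Finset.sum_congr rfl fun j hj => ?_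
    rw [Finset.mem_range] at hi hj
    rw [show a + b + c + 1 - i - j = a + 1 - 1 - i + (b + 1 - 1 - j) + c + 1 by lia]
  · intro n
    have := sum_range_choose_add_sum_range_choose n c
    zify at this
    simp only [Nat.zero_add, Finset.sum_range_zero]
    linarith
  · intro m
    have := sum_range_choose_add_sum_range_choose m c
    zify at this
    simp only [Nat.add_zero, Finset.sum_range_zero]
    linarith
  · intro m n
    have hm := sum_range_succ_choose_succ (m + n + c + 1) m
    have hn := sum_range_succ_choose_succ (m + n + c + 1) n
    have hc := sum_range_succ_choose_succ (m + n + c + 1) c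
    have hc' := Finset.sum_range_succ (fun ℓ => (m + n + c + 1).choose ℓ) c
    zify at hm hn hc hc'
    simp only [show m + 1 + (n + 1) + c = m + n + c + 1 + 1 by ring,
      show m + (n + 1) + c = m + n + c + 1 by ring,
      show m + 1 + n + c = m + n + c + 1 by ring, pow_succ _ (m + n + c + 1)]
    linarith
end

section
/- For every integer r ≥ 2, f(r) = ∑_{i,j,k ≥ 0} C(r-1, i+j) · C(r-1, j+k) · C(r-1, i+k), where C(n,m) denotes the binomial coefficient (so C(n,m)=0 for m>n, making the triple sum finite). -/
/-- `f r = 2^(3r-4) - 3·∑_{j=0}^{r-3} C(3r-4, j)`; for `r ≥ 2` this is the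
number of triangulations of a triangle each of whose sides is subdivided by
`r-1` points. -/
def f (r : ℕ) : ℤ :=
  2 ^ (3 * r - 4) - 3 * ∑ j ∈ Finset.range (r - 2), ((3 * r - 4).choose j : ℤ)

/-- The sum of `g` against the `m`-th row of Pascal's triangle. -/
def chooseSum (m : ℕ) (g : ℕ → ℤ) : ℤ :=
  ∑ a ∈ Finset.range (m + 1), g a * (m.choose a : ℤ)

theorem chooseSum_add (m : ℕ) (g h : ℕ → ℤ) :
    chooseSum m (fun a => g a + h a) = chooseSum m g + chooseSum m h := by
  simp only [chooseSum, add_mul, Finset.sum_add_distrib]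

theorem chooseSum_sub (m : ℕ) (g h : ℕ → ℤ) :
    chooseSum m (fun a => g a - h a) = chooseSum m g - chooseSum m h := by
  simp only [chooseSum, sub_mul, Finset.sum_sub_distrib]

theorem chooseSum_succ (m : ℕ) (g : ℕ → ℤ) :
    chooseSum (m + 1) g = chooseSum m (fun a => g a + g (a + 1)) := by
  rw [chooseSum_add]
  simp only [chooseSum]
  rw [Finset.sum_range_succ']
  simp only [Nat.choose_succ_succ, Nat.cast_add, mul_add, Finset.sum_add_distrib]
  rw [Finset.sum_range_succ (fun x => g (x + 1) * (m.choose (x + 1) : ℤ)) m,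
    Finset.sum_range_succ' (fun x => g x * (m.choose x : ℤ)) m]
  simp
  ring

theorem chooseSum_comm (m n : ℕ) (h : ℕ → ℕ → ℤ) :
    chooseSum m (fun a => chooseSum n (h a)) =
      chooseSum n (fun b => chooseSum m (fun a => h a b)) := by
  simp only [chooseSum, Finset.sum_mul]
  rw [Finset.sum_comm]
  exact Finset.sum_congr rfl fun _ _ => Finset.sum_congr rfl fun _ _ => by ring

theorem chooseSum_chooseSum_add (m n : ℕ) (g : ℕ → ℤ) :
    chooseSum m (fun a => chooseSum n (fun b => g (a + b))) = chooseSum (m + n) g := by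
  induction m generalizing g with
  | zero => simp [chooseSum]
  | succ m ih =>
    rw [chooseSum_succ, chooseSum_add, ih g, Nat.add_right_comm, chooseSum_succ (m + n),
      chooseSum_add, ← ih (fun s => g (s + 1))]
    simp only [Nat.add_right_comm]

theorem chooseSum_reflect (m : ℕ) (g : ℕ → ℤ) :
    chooseSum m (fun a => g (m - a)) = chooseSum m g := by
  simp only [chooseSum]
  rw [← Finset.sum_range_reflect]
  refine Finset.sum_congr rfl fun a ha => ?_
  have ha : a ≤ m := Nat.lt_succ_iff.mp (Finset.mem_range.mp ha)
  rw [Nat.add_sub_cancel, Nat.sub_sub_self ha, Nat.choose_symm ha]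

theorem chooseSum_congr {m : ℕ} {g h : ℕ → ℤ} (H : ∀ a ≤ m, g a = h a) :
    chooseSum m g = chooseSum m h :=
  Finset.sum_congr rfl fun a ha => by
    rw [H a (Nat.lt_succ_iff.mp (Finset.mem_range.mp ha))]

theorem chooseSum_even (m : ℕ) :
    chooseSum (m + 1) (fun s => if Even s then 1 else 0) = 2 ^ m := by
  rw [chooseSum_succ, chooseSum_congr (h := fun _ => 1)]
  · simp only [chooseSum, one_mul]
    exact_mod_cast Nat.sum_range_choose m
  · intro a _
    by_cases h : Even a <;> simp [h, Nat.even_add_one]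

theorem chooseSum_lt_of_parity {m n : ℕ} (hnm : n ≤ m + 1) :
    chooseSum (m + 1) (fun s => if s < n ∧ Even (n + s) then 1 else 0) =
      ∑ j ∈ Finset.range (n - 1), (m.choose j : ℤ) := by
  rw [chooseSum_succ, chooseSum_congr (h := fun s => if s ∈ Finset.range (n - 1) then 1 else 0)]
  · simp only [chooseSum, ite_mul, one_mul, zero_mul]
    rw [Finset.sum_ite_mem, Finset.inter_eq_right.mpr]
    exact Finset.range_subset_range.mpr (by omega)
  · intro a _
    simp only [Finset.mem_range, Nat.even_iff]
    grind

theorem chooseSum_dominated (n : ℕ) :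
    chooseSum n (fun a => chooseSum n fun b => chooseSum n fun c =>
      if b + c < a ∧ Even (a + b + c) then 1 else 0) =
      chooseSum (n + (n + n)) (fun s => if s < n ∧ Even (n + s) then 1 else 0) := by
  rw [← chooseSum_chooseSum_add, ← chooseSum_reflect]
  refine chooseSum_congr fun a ha => ?_
  rw [← chooseSum_chooseSum_add n n
    (fun t => if a + t < n ∧ Even (n + (a + t)) then (1 : ℤ) else 0)]
  refine chooseSum_congr fun b _ => chooseSum_congr fun c _ => ?_
  simp only [Nat.even_iff]
  congr 1
  simp only [eq_iff_iff]
  omega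

theorem sum_choose_pairs_eq_chooseSum (n : ℕ) :
    ∑ i ∈ Finset.range (n + 1), ∑ j ∈ Finset.range (n + 1), ∑ k ∈ Finset.range (n + 1),
        (n.choose (i + j) * n.choose (j + k) * n.choose (i + k) : ℤ) =
      chooseSum n (fun a => chooseSum n fun b => chooseSum n fun c =>
        if a ≤ b + c ∧ b ≤ a + c ∧ c ≤ a + b ∧ Even (a + b + c) then 1 else 0) := by
  simp only [chooseSum, Finset.sum_mul, ← Finset.sum_product']
  refine Finset.sum_bij_ne_zero (fun p _ _ => (p.1 + p.2.1, p.2.1 + p.2.2, p.1 + p.2.2))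
    ?_ ?_ ?_ ?_
  · rintro ⟨i, j, k⟩ _ h
    simp only [ne_eq, mul_eq_zero, Nat.cast_eq_zero, Nat.choose_eq_zero_iff] at h
    simp only [Finset.mem_product, Finset.mem_range]
    omega
  · rintro ⟨i, j, k⟩ _ _ ⟨i', j', k'⟩ _ _ h
    simp only [Prod.mk.injEq] at h ⊢
    omega
  · rintro ⟨a, b, c⟩ hm h
    have ht : a ≤ b + c ∧ b ≤ a + c ∧ c ≤ a + b ∧ Even (a + b + c) := by
      by_contra hn
      simp [hn] at h
    simp only [Finset.mem_product, Finset.mem_range] at hm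
    obtain ⟨h1, h2, h3, s, hs⟩ := ht
    have e1 : s - b + (s - c) = a := by omega
    have e2 : s - c + (s - a) = b := by omega
    have e3 : s - b + (s - a) = c := by omega
    refine ⟨(s - b, s - c, s - a), ?_, ?_, ?_⟩
    · simp only [Finset.mem_product, Finset.mem_range]
      omega
    · simp only [e1, e2, e3, ne_eq, mul_eq_zero, Nat.cast_eq_zero, Nat.choose_eq_zero_iff]
      omega
    · simp only [e1, e2, e3]
  · rintro ⟨i, j, k⟩ _ _
    have ht : i + j ≤ j + k + (i + k) ∧ j + k ≤ i + j + (i + k) ∧ i + k ≤ i + j + (j + k) ∧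
        Even (i + j + (j + k) + (i + k)) :=
      ⟨by omega, by omega, by omega, i + j + k, by omega⟩
    simp only [if_pos ht]
    ring

theorem chooseSum_triangle (n : ℕ) :
    chooseSum n (fun a => chooseSum n fun b => chooseSum n fun c =>
        if a ≤ b + c ∧ b ≤ a + c ∧ c ≤ a + b ∧ Even (a + b + c) then 1 else 0) =
      chooseSum (n + (n + n)) (fun s => if Even s then 1 else 0) -
        3 * chooseSum (n + (n + n)) (fun s => if s < n ∧ Even (n + s) then 1 else 0) := by
  have split (a b c : ℕ) :
      (if a ≤ b + c ∧ b ≤ a + c ∧ c ≤ a + b ∧ Even (a + b + c) then (1 : ℤ) else 0) =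
        (if Even (a + (b + c)) then 1 else 0) - (if b + c < a ∧ Even (a + b + c) then 1 else 0) -
          (if a + c < b ∧ Even (b + a + c) then 1 else 0) -
          (if a + b < c ∧ Even (c + a + b) then 1 else 0) := by
    simp only [Nat.even_iff]
    grind
  simp only [split, chooseSum_sub]
  have total : chooseSum n (fun a => chooseSum n fun b => chooseSum n fun c =>
      if Even (a + (b + c)) then 1 else 0) =
      chooseSum (n + (n + n)) (fun s => if Even s then 1 else 0) := by
    rw [← chooseSum_chooseSum_add]
    exact chooseSum_congr fun a _ =>
      chooseSum_chooseSum_add n n (fun t => if Even (a + t) then 1 else 0)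
  have second := (chooseSum_comm n n fun a b => chooseSum n fun c =>
    if a + c < b ∧ Even (b + a + c) then 1 else 0).trans (chooseSum_dominated n)
  have third : chooseSum n (fun a => chooseSum n fun b => chooseSum n fun c =>
      if a + b < c ∧ Even (c + a + b) then 1 else 0) =
      chooseSum (n + (n + n)) (fun s => if s < n ∧ Even (n + s) then 1 else 0) := by
    rw [← chooseSum_dominated, chooseSum_congr fun a _ => chooseSum_comm n n _]
    exact chooseSum_comm n n _
  rw [total, chooseSum_dominated, second, third]
  ring

theorem finsum_choose_pairs_eq_sum (n : ℕ) :
    ∑ᶠ i : ℕ, ∑ᶠ j : ℕ, ∑ᶠ k : ℕ,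
        (n.choose (i + j) * n.choose (j + k) * n.choose (i + k) : ℤ) =
      ∑ i ∈ Finset.range (n + 1), ∑ j ∈ Finset.range (n + 1), ∑ k ∈ Finset.range (n + 1),
        (n.choose (i + j) * n.choose (j + k) * n.choose (i + k) : ℤ) := by
  have finsum_eq (g : ℕ → ℤ) (hg : ∀ a, n < a → g a = 0) :
      ∑ᶠ a, g a = ∑ a ∈ Finset.range (n + 1), g a := by
    refine finsum_eq_sum_of_support_subset _ fun a ha => ?_
    by_contra h
    exact ha (hg a (by simpa using h))
  have inner (i j : ℕ) := finsum_eq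
    (fun k => (n.choose (i + j) * n.choose (j + k) * n.choose (i + k) : ℤ))
    fun k hk => by simp [Nat.choose_eq_zero_of_lt (show n < i + k by omega)]
  simp only [inner]
  have middle (i : ℕ) := finsum_eq
    (fun j => ∑ k ∈ Finset.range (n + 1),
      (n.choose (i + j) * n.choose (j + k) * n.choose (i + k) : ℤ))
    fun j hj => by simp [Nat.choose_eq_zero_of_lt (show n < i + j by omega)]
  simp only [middle]
  exact finsum_eq _ fun i hi => Finset.sum_eq_zero fun j _ => by
    simp [Nat.choose_eq_zero_of_lt (show n < i + j by omega)]

/-- Benoit Cloitre's conjecture (OEIS A087809), proved in Theorem 5.2 of the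
paper: `f r` equals the triple binomial sum
`∑_{i,j,k ≥ 0} C(r-1, i+j)·C(r-1, j+k)·C(r-1, i+k)`. The triple sum has
finitely many nonzero terms, so it is expressed with `finsum`. -/
theorem f_eq_triple_binomial_sum (r : ℕ) (hr : 2 ≤ r) :
    f r =
      ∑ᶠ i : ℕ, ∑ᶠ j : ℕ, ∑ᶠ k : ℕ,
        ((r - 1).choose (i + j) * (r - 1).choose (j + k) *
          (r - 1).choose (i + k) : ℤ) := by
  obtain ⟨n, rfl⟩ : ∃ n, r = n + 2 := ⟨r - 2, by omega⟩
  rw [finsum_choose_pairs_eq_sum, sum_choose_pairs_eq_chooseSum, chooseSum_triangle, f]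
  have e : n + 2 - 1 + (n + 2 - 1 + (n + 2 - 1)) = 3 * (n + 2) - 4 + 1 := by omega
  rw [e, chooseSum_even, chooseSum_lt_of_parity (by omega), Nat.sub_sub]
end

section
/- For every natural number r, the identity f(r+2) = 3·C(3r+2, r) + ∑_{j=0}^{r} ((5j+1)/(2j+1)) · C(3j, j) · 8^{r-j} holds in ℚ, where C(n,m) denotes the binomial coefficient. -/
/-- Pascal's rule for partial row sums of binomial coefficients. -/
theorem sum_range_choose_succ_row (n k : ℕ) :
    ∑ j ∈ Finset.range (k + 1), ((n + 1).choose j : ℚ) =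
      2 * ∑ j ∈ Finset.range (k + 1), (n.choose j : ℚ) - (n.choose k : ℚ) := by
  induction k with
  | zero => norm_num
  | succ k ih =>
    rw [Finset.sum_range_succ, ih, Finset.sum_range_succ _ (k + 1), Nat.choose_succ_succ]
    push_cast
    ring

theorem sum_range_choose_three_mul_add_five (r : ℕ) :
    3 * ∑ j ∈ Finset.range (r + 2), ((3 * r + 5).choose j : ℚ) =
      8 * (3 * ∑ j ∈ Finset.range (r + 1), ((3 * r + 2).choose j : ℚ)) -
        (5 * (r : ℚ) + 6) / (2 * r + 3) * ((3 * r + 3).choose (r + 1) : ℚ) := by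
  have h₁ := sum_range_choose_succ_row (3 * r + 2) r
  have h₂ := sum_range_choose_succ_row (3 * r + 3) r
  have h₃ := sum_range_choose_succ_row (3 * r + 4) (r + 1)
  rw [Finset.sum_range_succ (fun j ↦ ((3 * r + 4).choose j : ℚ)) (r + 1)] at h₃
  have pascal : ((3 * r + 4).choose (r + 1) : ℚ) =
      (3 * r + 3).choose r + (3 * r + 3).choose (r + 1) :=
    mod_cast Nat.choose_succ_succ (3 * r + 3) r
  have absorb : ((3 * r + 3).choose (r + 1) : ℚ) = 3 * (3 * r + 2).choose r := by
    have h : ((3 * r + 2 + 1 : ℕ) : ℚ) * (3 * r + 2).choose r =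
        (3 * r + 3).choose (r + 1) * ((r + 1 : ℕ) : ℚ) :=
      mod_cast Nat.add_one_mul_choose_eq (3 * r + 2) r
    push_cast at h
    have hr : (r : ℚ) + 1 ≠ 0 := by positivity
    apply mul_right_cancel₀ hr
    linear_combination -h
  have shift : ((3 * r + 3).choose (r + 1) : ℚ) * (r + 1) =
      (3 * r + 3).choose r * (2 * r + 3) := by
    have h := Nat.choose_succ_right_eq (3 * r + 3) r
    rw [show 3 * r + 3 - r = 2 * r + 3 by omega] at h
    exact_mod_cast h
  have hd : (2 * (r : ℚ) + 3) ≠ 0 := by positivity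
  have ratio : (5 * (r : ℚ) + 6) / (2 * r + 3) * ((3 * r + 3).choose (r + 1) : ℚ) =
      (3 * r + 3).choose (r + 1) + 3 * (3 * r + 3).choose r := by
    field_simp
    linear_combination 3 * shift
  linear_combination 3 * h₃ + 6 * h₂ + 12 * h₁ + 3 * pascal + ratio + 4 * absorb

theorem four_mul_eight_pow_sub_sum_choose (r : ℕ) :
    4 * 8 ^ r - 3 * ∑ j ∈ Finset.range (r + 1), ((3 * r + 2).choose j : ℚ) =
      ∑ j ∈ Finset.range (r + 1),
        ((5 * (j : ℚ) + 1) / (2 * j + 1)) * ((3 * j).choose j : ℚ) * 8 ^ (r - j) := by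
  induction r with
  | zero => norm_num
  | succ r ih =>
    have hsum : ∑ j ∈ Finset.range (r + 1),
        ((5 * (j : ℚ) + 1) / (2 * j + 1)) * ((3 * j).choose j : ℚ) * 8 ^ (r + 1 - j) =
        8 * ∑ j ∈ Finset.range (r + 1),
          ((5 * (j : ℚ) + 1) / (2 * j + 1)) * ((3 * j).choose j : ℚ) * 8 ^ (r - j) := by
      rw [Finset.mul_sum]
      refine Finset.sum_congr rfl fun j hj ↦ ?_
      rw [Nat.succ_sub (Finset.mem_range_succ_iff.mp hj), pow_succ]
      ring
    rw [show 3 * (r + 1) + 2 = 3 * r + 5 by ring, sum_range_choose_three_mul_add_five,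
      Finset.sum_range_succ _ (r + 1), hsum, ← ih, Nat.sub_self,
      show 3 * (r + 1) = 3 * r + 3 by ring]
    push_cast
    ring

/-- Equation (k=3D) of the paper:
`f(r+2) = 3·C(3r+2, r) + ∑_{j=0}^{r} ((5j+1)/(2j+1))·C(3j, j)·8^(r-j)`,
as an identity in `ℚ`. -/
theorem f_add_two_formula (r : ℕ) :
    (f (r + 2) : ℚ) =
      3 * ((3 * r + 2).choose r : ℚ) +
        ∑ j ∈ Finset.range (r + 1),
          ((5 * (j : ℚ) + 1) / (2 * j + 1)) * ((3 * j).choose j : ℚ) *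
            8 ^ (r - j) := by
  rw [← four_mul_eight_pow_sub_sum_choose, Finset.sum_range_succ, f,
    show 3 * (r + 2) - 4 = 3 * r + 2 by omega, Nat.add_sub_cancel, pow_add, pow_mul]
  push_cast
  ring
end

section
/- Let N and s be natural numbers with N ≥ 3 and 2s ≤ N. Then, as real numbers, ∑_{m=0}^{s} (-1)^m · C(s,m) · Cat(N-m-2) = (4^{N-s} · 3^s / π) · ∫_{-∞}^{∞} u² · (1 - (4/3)u²)^s / (1+4u²)^N du, where C(s,m) is the binomial coefficient, Cat(n) is the n-th Catalan number, and the integral is the Bochner integral over ℝ (the integrand is absolutely integrable). -/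
open MeasureTheory

open Filter Topology

lemma add_two_mul_catalan_succ (n : ℕ) :
    (n + 2) * catalan (n + 1) = 2 * (2 * n + 1) * catalan n := by
  have h := Nat.succ_mul_centralBinom_succ n
  rw [← succ_mul_catalan_eq_centralBinom, ← succ_mul_catalan_eq_centralBinom] at h
  have hn : 0 < n + 1 := n.succ_pos
  refine Nat.eq_of_mul_eq_mul_left hn ?_
  linarith

lemma integrable_sq_div_one_add_four_mul_sq_pow (n : ℕ) :
    Integrable fun u : ℝ ↦ u ^ 2 / (1 + 4 * u ^ 2) ^ (n + 2) := by
  have hpos (u : ℝ) : 0 < 1 + 4 * u ^ 2 := by positivity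
  refine integrable_inv_one_add_sq.mono' (Continuous.aestronglyMeasurable ?_) (ae_of_all _ fun u ↦ ?_)
  · exact Continuous.div (by fun_prop) (by fun_prop) fun u ↦ (pow_pos (hpos u) _).ne'
  · rw [Real.norm_of_nonneg (by positivity), div_le_iff₀ (by positivity), inv_mul_eq_div,
      le_div_iff₀ (by positivity)]
    calc u ^ 2 * (1 + u ^ 2) ≤ (1 + 4 * u ^ 2) ^ 2 := by nlinarith [sq_nonneg u, sq_nonneg (u ^ 2)]
      _ ≤ (1 + 4 * u ^ 2) ^ (n + 2) :=
        pow_le_pow_right₀ (by nlinarith [sq_nonneg u]) (by omega)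

/-- The bound used to see that boundary terms vanish at infinity. -/
lemma abs_cube_div_one_add_four_mul_sq_pow_le (n : ℕ) (u : ℝ) :
    |u ^ 3 / (1 + 4 * u ^ 2) ^ (n + 2)| ≤ |u|⁻¹ := by
  rcases eq_or_ne u 0 with rfl | hu
  · simp
  have hu' : 0 < |u| := abs_pos.mpr hu
  have hpos : 0 < 1 + 4 * u ^ 2 := by positivity
  rw [abs_div, abs_of_pos (pow_pos hpos _), div_le_iff₀ (pow_pos hpos _), inv_mul_eq_div,
    le_div_iff₀ hu', abs_pow]
  calc |u| ^ 3 * |u| = (u ^ 2) ^ 2 := by rw [← sq_abs u]; ring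
    _ ≤ (1 + 4 * u ^ 2) ^ 2 := by nlinarith [sq_nonneg u, sq_nonneg (u ^ 2)]
    _ ≤ (1 + 4 * u ^ 2) ^ (n + 2) :=
      pow_le_pow_right₀ (by nlinarith [sq_nonneg u]) (by omega)

lemma abs_div_one_add_four_mul_sq_le (u : ℝ) : |u / (1 + 4 * u ^ 2)| ≤ |u|⁻¹ := by
  rcases eq_or_ne u 0 with rfl | hu
  · simp
  have hu' : 0 < |u| := abs_pos.mpr hu
  have hpos : 0 < 1 + 4 * u ^ 2 := by positivity
  rw [abs_div, abs_of_pos hpos, div_le_iff₀ hpos, inv_mul_eq_div, le_div_iff₀ hu']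
  nlinarith [abs_mul_abs_self u, sq_nonneg u]

lemma tendsto_zero_of_abs_le_abs_inv {f : ℝ → ℝ} (hf : ∀ u, |f u| ≤ |u|⁻¹) :
    Tendsto f atBot (𝓝 0) ∧ Tendsto f atTop (𝓝 0) :=
  ⟨squeeze_zero_norm hf (tendsto_inv_atTop_zero.comp tendsto_abs_atBot_atTop),
    squeeze_zero_norm hf (tendsto_inv_atTop_zero.comp tendsto_abs_atTop_atTop)⟩

lemma hasDerivAt_one_add_four_mul_sq (u : ℝ) :
    HasDerivAt (fun u : ℝ ↦ 1 + 4 * u ^ 2) (8 * u) u := by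
  refine (((hasDerivAt_pow 2 u).const_mul 4).const_add 1).congr_deriv ?_
  norm_num
  ring

lemma integral_sq_div_one_add_four_mul_sq_sq :
    ∫ u : ℝ, u ^ 2 / (1 + 4 * u ^ 2) ^ 2 = Real.pi / 16 := by
  have hderiv (u : ℝ) : HasDerivAt
      (fun u : ℝ ↦ Real.arctan (2 * u) / 16 - u / (1 + 4 * u ^ 2) / 8)
      (u ^ 2 / (1 + 4 * u ^ 2) ^ 2) u := by
    have hpos : 0 < 1 + 4 * u ^ 2 := by positivity
    have h2 : HasDerivAt (fun u : ℝ ↦ 2 * u) 2 u := by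
      simpa using (hasDerivAt_id u).const_mul 2
    have hden := hasDerivAt_one_add_four_mul_sq u
    refine ((h2.arctan.div_const 16).sub
      (((hasDerivAt_id u).div hden hpos.ne').div_const 8)).congr_deriv ?_
    have : 1 + (2 * u) ^ 2 = 1 + 4 * u ^ 2 := by ring
    rw [this]
    simp only [id]
    field_simp
    ring
  obtain ⟨hbot, htop⟩ := tendsto_zero_of_abs_le_abs_inv abs_div_one_add_four_mul_sq_le
  have hArctanBot : Tendsto (fun u : ℝ ↦ Real.arctan (2 * u)) atBot (𝓝 (-(Real.pi / 2))) :=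
    (tendsto_nhds_of_tendsto_nhdsWithin Real.tendsto_arctan_atBot).comp
      (tendsto_id.const_mul_atBot (by norm_num))
  have hArctanTop : Tendsto (fun u : ℝ ↦ Real.arctan (2 * u)) atTop (𝓝 (Real.pi / 2)) :=
    (tendsto_nhds_of_tendsto_nhdsWithin Real.tendsto_arctan_atTop).comp
      (tendsto_id.const_mul_atTop (by norm_num))
  rw [integral_of_hasDerivAt_of_tendsto hderiv (integrable_sq_div_one_add_four_mul_sq_pow 0)
    ((hArctanBot.div_const 16).sub (hbot.div_const 8))
    ((hArctanTop.div_const 16).sub (htop.div_const 8))]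
  ring

lemma integral_sq_div_one_add_four_mul_sq_pow_succ (n : ℕ) :
    2 * ((n : ℝ) + 2) * ∫ u : ℝ, u ^ 2 / (1 + 4 * u ^ 2) ^ (n + 1 + 2) =
      (2 * (n : ℝ) + 1) * ∫ u : ℝ, u ^ 2 / (1 + 4 * u ^ 2) ^ (n + 2) := by
  have hint := ((integrable_sq_div_one_add_four_mul_sq_pow (n + 1)).const_mul (2 * ((n : ℝ) + 2))).sub
    ((integrable_sq_div_one_add_four_mul_sq_pow n).const_mul (2 * (n : ℝ) + 1))
  have hderiv (u : ℝ) : HasDerivAt (fun u : ℝ ↦ u ^ 3 / (1 + 4 * u ^ 2) ^ (n + 2))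
      (2 * (n + 2) * (u ^ 2 / (1 + 4 * u ^ 2) ^ (n + 1 + 2)) -
        (2 * n + 1) * (u ^ 2 / (1 + 4 * u ^ 2) ^ (n + 2))) u := by
    have hpos : 0 < 1 + 4 * u ^ 2 := by positivity
    have hden := hasDerivAt_one_add_four_mul_sq u
    refine ((hasDerivAt_pow 3 u).div (hden.pow (n + 2)) (pow_pos hpos _).ne').congr_deriv ?_
    have hne := hpos.ne'
    simp only [Pi.pow_apply, show n + 2 - 1 = n + 1 by omega]
    push_cast
    field_simp
    ring
  obtain ⟨hbot, htop⟩ :=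
    tendsto_zero_of_abs_le_abs_inv (abs_cube_div_one_add_four_mul_sq_pow_le n)
  have h := integral_of_hasDerivAt_of_tendsto hderiv hint hbot htop
  rw [integral_sub ((integrable_sq_div_one_add_four_mul_sq_pow (n + 1)).const_mul _)
    ((integrable_sq_div_one_add_four_mul_sq_pow n).const_mul _),
    integral_const_mul, integral_const_mul] at h
  linarith

lemma catalan_eq_integral (n : ℕ) :
    (catalan n : ℝ) =
      4 ^ (n + 2) / Real.pi * ∫ u : ℝ, u ^ 2 / (1 + 4 * u ^ 2) ^ (n + 2) := by
  have hpi := Real.pi_ne_zero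
  induction n with
  | zero =>
    rw [zero_add, integral_sq_div_one_add_four_mul_sq_sq, catalan_zero]
    field_simp
    norm_num
  | succ n ih =>
    have hcat : ((n : ℝ) + 2) * catalan (n + 1) = 2 * (2 * n + 1) * catalan n := by
      exact_mod_cast add_two_mul_catalan_succ n
    have hrec := integral_sq_div_one_add_four_mul_sq_pow_succ n
    have hn : (n : ℝ) + 2 ≠ 0 := by positivity
    refine mul_left_cancel₀ hn ?_
    rw [hcat, ih]
    linear_combination (-2 * 4 ^ (n + 2) / Real.pi) * hrec

/-- Binomial expansion of `(3 / 4 - u ^ 2) ^ s` in powers of `1 + 4 * u ^ 2`. -/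
lemma sum_choose_mul_sq_div_one_add_four_mul_sq_pow {N s : ℕ} (hs : s ≤ N) (u : ℝ) :
    ∑ m ∈ Finset.range (s + 1),
        (-1) ^ m * (s.choose m : ℝ) * 4 ^ (N - m) * (u ^ 2 / (1 + 4 * u ^ 2) ^ (N - m)) =
      4 ^ (N - s) * 3 ^ s *
        (u ^ 2 * (1 - (4 / 3) * u ^ 2) ^ s / (1 + 4 * u ^ 2) ^ N) := by
  have hne : 1 + 4 * u ^ 2 ≠ 0 := by positivity
  have hpow : (3 : ℝ) ^ s * (1 - (4 / 3) * u ^ 2) ^ s = (-(1 + 4 * u ^ 2) + 4) ^ s := by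
    rw [← mul_pow]
    ring
  calc _ = ∑ m ∈ Finset.range (s + 1), 4 ^ (N - s) * (u ^ 2 / (1 + 4 * u ^ 2) ^ N) *
        ((-(1 + 4 * u ^ 2)) ^ m * 4 ^ (s - m) * (s.choose m : ℝ)) := by
        refine Finset.sum_congr rfl fun m hm ↦ ?_
        have hm : m ≤ s := Nat.lt_succ_iff.mp (Finset.mem_range.mp hm)
        have h4 : (4 : ℝ) ^ (N - m) = 4 ^ (N - s) * 4 ^ (s - m) := by
          rw [← pow_add]; congr 1; omega
        have hN : (1 + 4 * u ^ 2) ^ N = (1 + 4 * u ^ 2) ^ (N - m) * (1 + 4 * u ^ 2) ^ m := by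
          rw [← pow_add]; congr 1; omega
        rw [h4, hN, neg_pow (1 + 4 * u ^ 2) m]
        field_simp
    _ = 4 ^ (N - s) * (u ^ 2 / (1 + 4 * u ^ 2) ^ N) * (-(1 + 4 * u ^ 2) + 4) ^ s := by
        rw [← Finset.mul_sum, ← add_pow]
    _ = _ := by
        rw [← hpow]
        ring

/-- Proposition 7.1 of the paper: for `N ≥ 3` and `2s ≤ N`, the number
`T(N,s) = ∑_{m=0}^{s} (-1)^m C(s,m) Cat(N-m-2)` of triangulations of a
convex polygon with `N` vertices of which `s` sides are subdivided by one
extra point each is given by the integral representation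
`T(N,s) = (4^(N-s) 3^s / π) ∫_{-∞}^{∞} u² (1 - (4/3)u²)^s / (1+4u²)^N du`. -/
theorem partially_subdivided_integral_representation (N s : ℕ) (hN : 3 ≤ N)
    (hs : 2 * s ≤ N) :
    ((∑ m ∈ Finset.range (s + 1),
        (-1) ^ m * (s.choose m : ℤ) * (catalan (N - m - 2) : ℤ) : ℤ) : ℝ) =
      (4 ^ (N - s) * 3 ^ s / Real.pi) *
        ∫ u : ℝ, u ^ 2 * (1 - (4 / 3) * u ^ 2) ^ s / (1 + 4 * u ^ 2) ^ N := by
  have hterm (m : ℕ) (hm : m ∈ Finset.range (s + 1)) :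
      (-1) ^ m * (s.choose m : ℝ) * (catalan (N - m - 2) : ℝ) =
        1 / Real.pi * ∫ u : ℝ, (-1) ^ m * (s.choose m : ℝ) * 4 ^ (N - m) *
          (u ^ 2 / (1 + 4 * u ^ 2) ^ (N - m)) := by
    have hm : m < s + 1 := Finset.mem_range.mp hm
    rw [catalan_eq_integral, show N - m - 2 + 2 = N - m by omega, integral_const_mul]
    ring
  have hint (m : ℕ) (hm : m ∈ Finset.range (s + 1)) :
      Integrable fun u : ℝ ↦ (-1) ^ m * (s.choose m : ℝ) * 4 ^ (N - m) *
        (u ^ 2 / (1 + 4 * u ^ 2) ^ (N - m)) := by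
    have hm : m < s + 1 := Finset.mem_range.mp hm
    have h := integrable_sq_div_one_add_four_mul_sq_pow (N - m - 2)
    rw [show N - m - 2 + 2 = N - m by omega] at h
    exact h.const_mul _
  push_cast
  rw [Finset.sum_congr rfl hterm, ← Finset.mul_sum, ← integral_finsetSum _ hint]
  simp_rw [sum_choose_mul_sq_div_one_add_four_mul_sq_pow (show s ≤ N by omega)]
  rw [integral_const_mul]
  ring
end

section
/- Let α be a real number with 0 ≤ α ≤ 1/2, and let N, s : ℕ → ℕ be sequences such that N(n) → ∞ as n → ∞, N(n) ≥ 3 and 2·s(n) ≤ N(n) for all n, and s(n)/N(n) → α as n → ∞. Define T(N,s) := ∑_{m=0}^{s} (-1)^m · C(s,m) · Cat(N-m-2). Then the sequence of real numbers (T(N(n), s(n)) · 16 · √π · (1 + α/3)^{3/2} · N(n)^{3/2} / (4^{N(n)-s(n)} · 3^{s(n)}))_{n} tends to 1 as n → ∞. -/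
open Filter

/-- `T N s = ∑_{m=0}^{s} (-1)^m C(s,m) Cat(N-m-2)`, the number of
triangulations of a convex polygon with `N` vertices in total of which `s`
sides are subdivided by one extra point each. -/
def T (N s : ℕ) : ℤ :=
  ∑ m ∈ Finset.range (s + 1),
    (-1) ^ m * (s.choose m : ℤ) * (catalan (N - m - 2) : ℤ)

open Real Set MeasureTheory intervalIntegral

theorem prod_odd_div_even_eq_centralBinom (n : ℕ) :
    ∏ i ∈ Finset.range n, (2 * (i : ℝ) + 1) / (2 * i + 2) = n.centralBinom / 4 ^ n := by
  induction n with
  | zero => simp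
  | succ n ih =>
    have h : ((n : ℝ) + 1) * (n + 1).centralBinom = 2 * (2 * n + 1) * n.centralBinom := by
      exact_mod_cast n.succ_mul_centralBinom_succ
    have hn : (n : ℝ) + 1 ≠ 0 := by positivity
    rw [Finset.prod_range_succ, ih, eq_comm, div_eq_iff (by positivity)]
    apply mul_left_cancel₀ hn
    rw [h]
    field_simp
    ring

theorem integral_cos_pow_even_eq_centralBinom (n : ℕ) :
    ∫ θ in (0)..(π / 2), cos θ ^ (2 * n) = π / 2 * (n.centralBinom / 4 ^ n) := by
  rw [EulerSine.integral_cos_pow_eq, integral_sin_pow_even, prod_odd_div_even_eq_centralBinom]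
  ring

/-- The Catalan numbers are the moments of the Marchenko–Pastur law. -/
theorem catalan_eq_integral_s16 (n : ℕ) :
    (catalan n : ℝ) = 4 / π * ∫ θ in (0)..(π / 2), (4 * cos θ ^ 2) ^ n * sin θ ^ 2 := by
  have hint (m : ℕ) : IntervalIntegrable (fun θ => cos θ ^ m) volume 0 (π / 2) :=
    (by fun_prop : Continuous fun θ => cos θ ^ m).intervalIntegrable _ _
  have hsplit : ∫ θ in (0)..(π / 2), (4 * cos θ ^ 2) ^ n * sin θ ^ 2 =
      4 ^ n * ((∫ θ in (0)..(π / 2), cos θ ^ (2 * n)) -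
        ∫ θ in (0)..(π / 2), cos θ ^ (2 * (n + 1))) := by
    rw [← integral_sub (hint _) (hint _), ← intervalIntegral.integral_const_mul]
    congr 1 with θ
    rw [sin_sq, mul_pow, pow_mul, pow_mul]
    ring
  have hc : ((n : ℝ) + 1) * catalan n = n.centralBinom := by
    exact_mod_cast succ_mul_catalan_eq_centralBinom n
  have hs : ((n : ℝ) + 1) * (n + 1).centralBinom = 2 * (2 * n + 1) * n.centralBinom := by
    exact_mod_cast n.succ_mul_centralBinom_succ
  have hn : (n : ℝ) + 1 ≠ 0 := by positivity
  rw [hsplit, integral_cos_pow_even_eq_centralBinom, integral_cos_pow_even_eq_centralBinom]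
  apply mul_left_cancel₀ hn
  rw [hc]
  field_simp
  linear_combination 4 * 4 ^ n * hs

theorem sum_neg_one_pow_mul_choose_mul_pow {R : Type*} [CommRing R] (x : R) (k s : ℕ) :
    ∑ m ∈ Finset.range (s + 1), (-1) ^ m * (s.choose m : R) * x ^ (k + s - m) =
      x ^ k * (x - 1) ^ s := by
  rw [sub_eq_neg_add, add_pow, Finset.mul_sum]
  refine Finset.sum_congr rfl fun m hm => ?_
  rw [Nat.add_sub_assoc (Finset.mem_range_succ_iff.mp hm), pow_add]
  ring

theorem T_eq_integral (k s : ℕ) :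
    (T (k + s + 2) s : ℝ) = 4 / π * (4 ^ k * 3 ^ s * ∫ θ in (0)..(π / 2),
      (1 - sin θ ^ 2) ^ k * (1 - 4 / 3 * sin θ ^ 2) ^ s * sin θ ^ 2) := by
  have hT : (T (k + s + 2) s : ℝ) = 4 / π * ∑ m ∈ Finset.range (s + 1),
      ∫ θ in (0)..(π / 2),
        (-1) ^ m * (s.choose m : ℝ) * (4 * cos θ ^ 2) ^ (k + s - m) * sin θ ^ 2 := by
    rw [T, Int.cast_sum, Finset.mul_sum]
    refine Finset.sum_congr rfl fun m _ => ?_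
    rw [show k + s + 2 - m - 2 = k + s - m by omega]
    push_cast
    rw [catalan_eq_integral_s16]
    simp_rw [mul_assoc ((-1 : ℝ) ^ m * (s.choose m : ℝ))]
    rw [intervalIntegral.integral_const_mul]
    ring
  rw [hT, ← intervalIntegral.integral_finsetSum fun m _ =>
    Continuous.intervalIntegrable (by fun_prop) _ _]
  congr 1
  rw [← intervalIntegral.integral_const_mul]
  refine integral_congr fun θ _ => ?_
  rw [← Finset.sum_mul, sum_neg_one_pow_mul_choose_mul_pow, cos_sq',
    show 4 * (1 - sin θ ^ 2) - 1 = 3 * (1 - 4 / 3 * sin θ ^ 2) by ring, mul_pow, mul_pow]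
  ring

theorem integral_sq_mul_exp_neg_mul_sq {c : ℝ} (hc : 0 < c) :
    ∫ y in Ioi (0 : ℝ), y ^ 2 * exp (-c * y ^ 2) = √π / (4 * c ^ (3 / 2 : ℝ)) := by
  have h := integral_rpow_mul_exp_neg_mul_rpow (p := 2) (q := 2) (by norm_num) (by norm_num) hc
  have hG : Gamma (((2 : ℝ) + 1) / 2) = 1 / 2 * √π := by
    rw [show ((2 : ℝ) + 1) / 2 = 1 / 2 + 1 by norm_num, Gamma_add_one (by norm_num),
      Gamma_one_half_eq]
  simp_rw [rpow_two] at h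
  rw [h, hG, show -((2 : ℝ) + 1) / 2 = -(3 / 2) by norm_num, rpow_neg hc.le]
  field_simp
  norm_num

theorem tendsto_mul_sin_sq_div_sqrt (y : ℝ) :
    Tendsto (fun x : ℝ => x * sin (y / √x) ^ 2) atTop (nhds (y ^ 2)) := by
  have h0 : Tendsto (fun x : ℝ => y / √x) atTop (nhds 0) :=
    tendsto_const_nhds.div_atTop tendsto_sqrt_atTop
  have h := ((continuous_sinc.tendsto 0).comp h0).pow 2 |>.const_mul (y ^ 2)
  rw [sinc_zero, one_pow, mul_one] at h
  refine h.congr' ?_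
  filter_upwards [eventually_gt_atTop 0] with x hx
  rcases eq_or_ne y 0 with rfl | hy
  · simp
  · have hs : √x ≠ 0 := (sqrt_pos.mpr hx).ne'
    simp only [Function.comp_apply]
    rw [sinc_of_ne_zero (div_ne_zero hy hs)]
    field_simp
    rw [sq_sqrt hx.le, mul_comm]

/-- If `k / N → β` and `N → ∞`, then `(1 - a sin² (y / √N)) ^ k → exp (-β a y²)`. -/
theorem tendsto_one_sub_mul_sin_sq_pow {ι : Type*} {l : Filter ι} {N k : ι → ℕ} {β : ℝ}
    (hN : Tendsto N l atTop) (hk : Tendsto (fun n => (k n : ℝ) / N n) l (nhds β)) (a y : ℝ) :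
    Tendsto (fun n => (1 - a * sin (y / √(N n)) ^ 2) ^ k n) l (nhds (exp (-(β * (a * y ^ 2))))) := by
  have hNR : Tendsto (fun n => (N n : ℝ)) l atTop := tendsto_natCast_atTop_atTop.comp hN
  have hg : Tendsto (fun x : ℝ => x * -(a * sin (y / √x) ^ 2)) atTop (nhds (-(a * y ^ 2))) :=
    ((tendsto_mul_sin_sq_div_sqrt y).const_mul a).neg.congr fun x => by ring
  have hlog := (tendsto_mul_log_one_add_of_tendsto hg).comp hNR
  have hbase : Tendsto (fun x : ℝ => 1 - a * sin (y / √x) ^ 2) atTop (nhds 1) := by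
    have h0 : Tendsto (fun x : ℝ => y / √x) atTop (nhds 0) :=
      tendsto_const_nhds.div_atTop tendsto_sqrt_atTop
    have hcont : Continuous fun t : ℝ => 1 - a * sin t ^ 2 := by fun_prop
    exact (hcont.tendsto' 0 1 (by simp)).comp h0
  have hexp := (continuous_exp.tendsto _).comp (hk.mul hlog)
  rw [mul_neg] at hexp
  refine hexp.congr' ?_
  filter_upwards [hNR.eventually (hbase.eventually (lt_mem_nhds one_pos)),
    hNR.eventually_gt_atTop 0] with n hpos hNpos
  simp only [Function.comp_apply, ← sub_eq_add_neg]
  rw [← mul_assoc, div_mul_cancel₀ _ hNpos.ne', ← log_pow, exp_log (pow_pos hpos _)]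

theorem one_sub_sin_sq_le_exp {θ : ℝ} (h0 : 0 ≤ θ) (h1 : θ ≤ π / 2) :
    1 - sin θ ^ 2 ≤ exp (-(θ ^ 2 / 4)) := by
  have hsin : θ / 2 ≤ sin θ := by
    refine le_trans ?_ (mul_le_sin h0 h1)
    rw [div_mul_eq_mul_div, div_le_div_iff₀ two_pos pi_pos]
    nlinarith [pi_le_four]
  have hexp := add_one_le_exp (-(θ ^ 2 / 4))
  nlinarith

theorem abs_laplace_kernel_le {θ : ℝ} (h0 : 0 ≤ θ) (h1 : θ ≤ π / 2) (k s : ℕ) :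
    |(1 - sin θ ^ 2) ^ k * (1 - 4 / 3 * sin θ ^ 2) ^ s * sin θ ^ 2| ≤
      exp (-(k * (θ ^ 2 / 4))) * θ ^ 2 := by
  have hs1 := sin_sq_le_one θ
  have hs0 := sq_nonneg (sin θ)
  have hk : |(1 - sin θ ^ 2) ^ k| ≤ exp (-(k * (θ ^ 2 / 4))) := by
    rw [abs_of_nonneg (pow_nonneg (by linarith) _), ← mul_neg, exp_nat_mul]
    exact pow_le_pow_left₀ (by linarith) (one_sub_sin_sq_le_exp h0 h1) k
  have hs : |(1 - 4 / 3 * sin θ ^ 2) ^ s| ≤ 1 := by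
    rw [abs_pow]
    exact pow_le_one₀ (abs_nonneg _) (abs_le.mpr ⟨by linarith, by linarith⟩)
  have hsin : |sin θ ^ 2| ≤ θ ^ 2 := by
    rw [abs_of_nonneg hs0, sq_le_sq]
    exact abs_sin_le_abs
  rw [abs_mul, abs_mul]
  calc _ ≤ exp (-(k * (θ ^ 2 / 4))) * 1 * θ ^ 2 := by gcongr
    _ = _ := by ring

theorem tendsto_laplace_integral {α : ℝ} {N s k : ℕ → ℕ} (hN : Tendsto N atTop atTop)
    (hs : Tendsto (fun n => (s n : ℝ) / N n) atTop (nhds α))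
    (hk : Tendsto (fun n => (k n : ℝ) / N n) atTop (nhds (1 - α)))
    (hkN : ∀ᶠ n in atTop, N n ≤ 4 * k n) :
    Tendsto (fun n => (N n : ℝ) ^ (3 / 2 : ℝ) * ∫ θ in (0)..(π / 2),
        (1 - sin θ ^ 2) ^ k n * (1 - 4 / 3 * sin θ ^ 2) ^ s n * sin θ ^ 2) atTop
      (nhds (∫ y in Ioi (0 : ℝ), y ^ 2 * exp (-(1 + α / 3) * y ^ 2))) := by
  have hNR : Tendsto (fun n => (N n : ℝ)) atTop atTop := tendsto_natCast_atTop_atTop.comp hN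
  have hsqrt : Tendsto (fun n => √(N n : ℝ)) atTop atTop := tendsto_sqrt_atTop.comp hNR
  let f (n : ℕ) (θ : ℝ) : ℝ :=
    (1 - sin θ ^ 2) ^ k n * (1 - 4 / 3 * sin θ ^ 2) ^ s n * sin θ ^ 2
  have hf (n : ℕ) : Continuous (f n) := by unfold f; fun_prop
  let F (n : ℕ) : ℝ → ℝ :=
    (Ioc 0 (π / 2 * √(N n))).indicator fun y => N n * f n (y / √(N n))
  have hF : ∀ᶠ n in atTop, ∫ y in Ioi (0 : ℝ), F n y =
      (N n : ℝ) ^ (3 / 2 : ℝ) * ∫ θ in (0)..(π / 2), f n θ := by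
    filter_upwards [hNR.eventually_gt_atTop 0] with n hn
    have hr : 0 < √(N n : ℝ) := sqrt_pos.mpr hn
    rw [setIntegral_indicator measurableSet_Ioc,
      inter_eq_right.mpr Ioc_subset_Ioi_self, ← integral_of_le (by positivity),
      intervalIntegral.integral_const_mul, integral_comp_div _ hr.ne', zero_div,
      mul_div_cancel_right₀ _ hr.ne', smul_eq_mul, ← mul_assoc,
      show (3 / 2 : ℝ) = 1 + 1 / 2 by norm_num, rpow_add hn, rpow_one, ← sqrt_eq_rpow]
  refine Tendsto.congr' hF ?_
  refine tendsto_integral_filter_of_dominated_convergence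
    (fun y => y ^ 2 * exp (-(1 / 16) * y ^ 2)) ?_ ?_ ?_ ?_
  · refine Eventually.of_forall fun n => ?_
    have := hf n
    exact (Continuous.aestronglyMeasurable (by fun_prop)).indicator measurableSet_Ioc
  · filter_upwards [hkN, hNR.eventually_gt_atTop 0] with n hkn hn
    refine Eventually.of_forall fun y => ?_
    by_cases hy : y ∈ Ioc 0 (π / 2 * √(N n))
    · have hr : 0 < √(N n : ℝ) := sqrt_pos.mpr hn
      have hb := abs_laplace_kernel_le (div_nonneg hy.1.le hr.le) ((div_le_iff₀ hr).mpr hy.2)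
        (k n) (s n)
      have hkn' : (N n : ℝ) ≤ 4 * k n := by exact_mod_cast hkn
      rw [div_pow, sq_sqrt hn.le] at hb
      simp only [F, f, indicator_of_mem hy, norm_eq_abs]
      rw [abs_mul, abs_of_pos hn]
      calc _ ≤ (N n : ℝ) * (exp (-(k n * (y ^ 2 / N n / 4))) * (y ^ 2 / N n)) := by gcongr
        _ = y ^ 2 * exp (-(k n / (4 * N n) * y ^ 2)) := by
          field_simp
        _ ≤ _ := by
          have : 1 / 16 ≤ (k n : ℝ) / (4 * N n) := by
            rw [div_le_div_iff₀ (by norm_num) (by positivity)]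
            linarith
          rw [neg_mul]
          gcongr
    · simp only [F, indicator_of_notMem hy, norm_zero]
      positivity
  · simpa only [rpow_two, IntegrableOn] using integrableOn_rpow_mul_exp_neg_mul_sq
      (show (0 : ℝ) < 1 / 16 by norm_num) (show (-1 : ℝ) < 2 by norm_num)
  · refine (ae_restrict_mem measurableSet_Ioi).mono fun y hy => ?_
    have hlim := ((tendsto_one_sub_mul_sin_sq_pow hN hk 1 y).mul
      (tendsto_one_sub_mul_sin_sq_pow hN hs (4 / 3) y)).mul
      ((tendsto_mul_sin_sq_div_sqrt y).comp hNR)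
    rw [← exp_add, mul_comm, show -((1 - α) * (1 * y ^ 2)) + -(α * (4 / 3 * y ^ 2)) =
      -(1 + α / 3) * y ^ 2 by ring] at hlim
    refine hlim.congr' ?_
    filter_upwards [hsqrt.eventually_ge_atTop (y / (π / 2))] with n hn
    have hmem : y ∈ Ioc 0 (π / 2 * √(N n)) :=
      ⟨hy, by rwa [div_le_iff₀' (by positivity)] at hn⟩
    simp only [F, f, indicator_of_mem hmem, Function.comp_apply, one_mul]
    ring

/-- Theorem 7.2 of the paper: if `N(n) → ∞`, `N(n) ≥ 3`, `2 s(n) ≤ N(n)`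
and `s(n)/N(n) → α` with `0 ≤ α ≤ 1/2`, then
`T(N,s) = 4^(N-s) 3^s / (16 √π (1+α/3)^(3/2) N^(3/2)) (1+o(1))`, i.e. the
displayed ratio tends to `1`. -/
theorem partially_subdivided_asymptotics (α : ℝ) (hα0 : 0 ≤ α)
    (hα1 : α ≤ 1 / 2) (N s : ℕ → ℕ)
    (hN : Tendsto (fun n => N n) atTop atTop)
    (hN3 : ∀ n, 3 ≤ N n) (hsN : ∀ n, 2 * s n ≤ N n)
    (hratio : Tendsto (fun n => (s n : ℝ) / (N n : ℝ)) atTop (nhds α)) :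
    Tendsto
      (fun n =>
        (T (N n) (s n) : ℝ) * 16 * Real.sqrt Real.pi *
            (1 + α / 3) ^ ((3 : ℝ) / 2) * (N n : ℝ) ^ ((3 : ℝ) / 2) /
          (4 ^ (N n - s n) * 3 ^ (s n)))
      atTop (nhds 1) := by
  obtain ⟨k, hk⟩ : ∃ k : ℕ → ℕ, ∀ n, 5 ≤ N n → N n = k n + s n + 2 :=
    ⟨fun n => N n - 2 - s n, fun n hn => by have := hsN n; dsimp only; omega⟩
  have hNR : Tendsto (fun n => (N n : ℝ)) atTop atTop := tendsto_natCast_atTop_atTop.comp hN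
  have hklim : Tendsto (fun n => (k n : ℝ) / N n) atTop (nhds (1 - α)) := by
    have h := (hratio.const_sub 1).sub (hNR.const_div_atTop 2)
    rw [sub_zero] at h
    refine h.congr' ?_
    filter_upwards [hN.eventually_ge_atTop 5] with n hn
    have hcast : (N n : ℝ) = k n + s n + 2 := by exact_mod_cast hk n hn
    have hpos : (N n : ℝ) ≠ 0 := by positivity
    field_simp
    linarith
  have hkN : ∀ᶠ n in atTop, N n ≤ 4 * k n := by
    filter_upwards [hN.eventually_ge_atTop 8] with n hn
    have := hk n (by omega)
    have := hsN n
    omega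
  have hc : 0 < 1 + α / 3 := by positivity
  have hlim := (tendsto_laplace_integral hN hratio hklim hkN).const_mul
    (4 / √π * (1 + α / 3) ^ (3 / 2 : ℝ))
  rw [integral_sq_mul_exp_neg_mul_sq hc, show 4 / √π * (1 + α / 3) ^ (3 / 2 : ℝ) *
    (√π / (4 * (1 + α / 3) ^ (3 / 2 : ℝ))) = 1 by field_simp] at hlim
  refine hlim.congr' ?_
  filter_upwards [hN.eventually_ge_atTop 5] with n hn
  have hT := T_eq_integral (k n) (s n)
  rw [← hk n hn] at hT
  have hpi : 4 / √π = 4 / π * √π := by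
    rw [div_mul_eq_mul_div, div_eq_div_iff (by positivity) pi_ne_zero, mul_assoc,
      mul_self_sqrt pi_pos.le]
  rw [hT, hpi, show N n - s n = k n + 2 by have := hk n hn; omega, pow_add]
  field_simp
  ring
end
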